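/- arXiv:1307.4029 — 4 statements merged into one kernel-verified Lean document; each statement's English description precedes it below -/
import Mathlib

section
/- If the vector configuration A has codimension 0 (i.e., ker_Z(A) = 0), then the toric fiber product ring K[z]/(I ×_A J) is isomorphic to the Segre product R ∘_{NA} S. -/
open MvPolynomial
open scoped TensorProduct Classical

noncomputable section

variable {K : Type*} [Field K] {d h : ℕ}

/-- The map `φ_S : K[z] → K[x] ⊗ K[y]`, `z^α_{β,γ} ↦ x^α_β ⊗ y^α_γ`. -/
def phiS (K : Type*) [Field K] (dx dy : Fin d → ℕ) :
    MvPolynomial (Σ α : Fin d, Fin (dx α) × Fin (dy α)) K →ₐ[K]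
      (MvPolynomial (Σ α : Fin d, Fin (dx α)) K ⊗[K]
        MvPolynomial (Σ α : Fin d, Fin (dy α)) K) :=
  aeval (fun s => (X ⟨s.1, s.2.1⟩ : MvPolynomial (Σ α : Fin d, Fin (dx α)) K) ⊗ₜ[K]
    (X ⟨s.1, s.2.2⟩ : MvPolynomial (Σ α : Fin d, Fin (dy α)) K))

/-- The composite map `(π_I ⊗ π_J) ∘ φ_S : K[z] → R ⊗ S`. -/
def psiTFP (K : Type*) [Field K] (dx dy : Fin d → ℕ)
    (I : Ideal (MvPolynomial (Σ α : Fin d, Fin (dx α)) K))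
    (J : Ideal (MvPolynomial (Σ α : Fin d, Fin (dy α)) K)) :
    MvPolynomial (Σ α : Fin d, Fin (dx α) × Fin (dy α)) K →ₐ[K]
      ((MvPolynomial (Σ α : Fin d, Fin (dx α)) K ⧸ I) ⊗[K]
        (MvPolynomial (Σ α : Fin d, Fin (dy α)) K ⧸ J)) :=
  (Algebra.TensorProduct.map (Ideal.Quotient.mkₐ K I) (Ideal.Quotient.mkₐ K J)).comp
    (phiS K dx dy)

/-- The toric fiber product `I ×_A J = ker((π_I ⊗ π_J) ∘ φ_S)`. -/
def TFP (K : Type*) [Field K] (dx dy : Fin d → ℕ)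
    (I : Ideal (MvPolynomial (Σ α : Fin d, Fin (dx α)) K))
    (J : Ideal (MvPolynomial (Σ α : Fin d, Fin (dy α)) K)) :
    Ideal (MvPolynomial (Σ α : Fin d, Fin (dx α) × Fin (dy α)) K) :=
  RingHom.ker (psiTFP K dx dy I J).toRingHom

/-- The homogeneous component of degree `v ∈ ℤ^h` of a polynomial, with respect to the
grading `deg (x^α_β) = a α`. -/
def homCompA (a : Fin d → Fin h → ℤ) {dx : Fin d → ℕ} (v : Fin h → ℤ)
    (p : MvPolynomial (Σ α : Fin d, Fin (dx α)) K) :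
    MvPolynomial (Σ α : Fin d, Fin (dx α)) K :=
  ∑ m ∈ p.support.filter (fun m => (∑ s, (m s : ℤ) • a s.1) = v), monomial m (coeff m p)

/-- An ideal is `ℕ𝒜`-homogeneous iff it contains all homogeneous components of its
elements. -/
def IsHomogA (a : Fin d → Fin h → ℤ) {dx : Fin d → ℕ}
    (I : Ideal (MvPolynomial (Σ α : Fin d, Fin (dx α)) K)) : Prop :=
  ∀ p ∈ I, ∀ v : Fin h → ℤ, homCompA a v p ∈ I

/-- The degree-`v` component of the quotient ring `K[x]/I`: the image of the span of
the monomials of degree `v`. -/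
def quotComp (a : Fin d → Fin h → ℤ) {dx : Fin d → ℕ} (v : Fin h → ℤ)
    (I : Ideal (MvPolynomial (Σ α : Fin d, Fin (dx α)) K)) :
    Submodule K (MvPolynomial (Σ α : Fin d, Fin (dx α)) K ⧸ I) :=
  (Submodule.span K {p : MvPolynomial (Σ α : Fin d, Fin (dx α)) K |
      ∃ m : (Σ α : Fin d, Fin (dx α)) →₀ ℕ,
        (∑ s, (m s : ℤ) • a s.1) = v ∧ p = monomial m 1}).map
    (Ideal.Quotient.mkₐ K I).toLinearMap

/-- The Segre product `⊕_v R_v ⊗ S_v` of `R = K[x]/I` and `S = K[y]/J` as a submodule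
of `R ⊗[K] S`. -/
def SegreQuot (a : Fin d → Fin h → ℤ) {dx dy : Fin d → ℕ}
    (I : Ideal (MvPolynomial (Σ α : Fin d, Fin (dx α)) K))
    (J : Ideal (MvPolynomial (Σ α : Fin d, Fin (dy α)) K)) :
    Submodule K ((MvPolynomial (Σ α : Fin d, Fin (dx α)) K ⧸ I) ⊗[K]
      (MvPolynomial (Σ α : Fin d, Fin (dy α)) K ⧸ J)) :=
  ⨆ v : Fin h → ℤ, Submodule.span K
    {x | ∃ r ∈ quotComp a v I, ∃ s ∈ quotComp a v J, x = r ⊗ₜ[K] s}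

/-- Degree of an exponent vector. -/
def degV (a : Fin d → Fin h → ℤ) {dx : Fin d → ℕ}
    (m : (Σ α : Fin d, Fin (dx α)) →₀ ℕ) : Fin h → ℤ := ∑ s, (m s : ℤ) • a s.1

/-- Multidegree counting the variables in each block. -/
def cnt {dx : Fin d → ℕ} (m : (Σ α : Fin d, Fin (dx α)) →₀ ℕ) (α : Fin d) : ℕ :=
  ∑ β, m ⟨α, β⟩

lemma degV_add (a : Fin d → Fin h → ℤ) {dx : Fin d → ℕ}
    (m n : (Σ α : Fin d, Fin (dx α)) →₀ ℕ) : degV a (m + n) = degV a m + degV a n := by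
  simp [degV, add_smul, Finset.sum_add_distrib]

lemma degV_single (a : Fin d → Fin h → ℤ) {dx : Fin d → ℕ}
    (s : Σ α : Fin d, Fin (dx α)) : degV a (Finsupp.single s 1) = a s.1 := by
  unfold degV
  rw [Finset.sum_eq_single s]
  · simp
  · intro b _ hb
    rw [Finsupp.single_eq_of_ne hb]
    simp
  · simp

lemma cnt_add {dx : Fin d → ℕ}
    (m n : (Σ α : Fin d, Fin (dx α)) →₀ ℕ) (α : Fin d) :
    cnt (m + n) α = cnt m α + cnt n α := by
  simp [cnt, Finset.sum_add_distrib]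

lemma cnt_single {dx : Fin d → ℕ} (s : Σ α : Fin d, Fin (dx α)) (α : Fin d) :
    cnt (Finsupp.single s 1) α = if s.1 = α then 1 else 0 := by
  obtain ⟨b, t⟩ := s
  unfold cnt
  split_ifs with hh
  · simp only at hh
    subst hh
    rw [Finset.sum_eq_single t]
    · simp
    · intro c _ hc
      apply Finsupp.single_eq_of_ne
      simpa using hc
    · simp
  · apply Finset.sum_eq_zero
    intro c _
    apply Finsupp.single_eq_of_ne
    intro h'
    apply hh
    exact (congrArg Sigma.fst h').symm

lemma degV_eq_cnt (a : Fin d → Fin h → ℤ) {dx : Fin d → ℕ}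
    (m : (Σ α : Fin d, Fin (dx α)) →₀ ℕ) : degV a m = ∑ α, (cnt m α : ℤ) • a α := by
  unfold degV cnt
  rw [Fintype.sum_sigma]
  simp [Finset.sum_smul]

lemma cnt_eq_of_degV_eq (a : Fin d → Fin h → ℤ) {dx dy : Fin d → ℕ}
    (hker : ∀ c : Fin d → ℤ, (∑ α, c α • a α) = 0 → c = 0)
    (m : (Σ α : Fin d, Fin (dx α)) →₀ ℕ) (n : (Σ α : Fin d, Fin (dy α)) →₀ ℕ)
    (hmn : degV a m = degV a n) (α : Fin d) : cnt m α = cnt n α := by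
  have := hker (fun α => (cnt m α : ℤ) - cnt n α) (by
    simp only [sub_smul, Finset.sum_sub_distrib]
    rw [← degV_eq_cnt, ← degV_eq_cnt, hmn, sub_self])
  have := congrFun this α
  simp only [Pi.zero_apply] at this
  omega

lemma psi_X (dx dy : Fin d → ℕ)
    (I : Ideal (MvPolynomial (Σ α : Fin d, Fin (dx α)) K))
    (J : Ideal (MvPolynomial (Σ α : Fin d, Fin (dy α)) K)) (s) :
    psiTFP K dx dy I J (X s) = (Ideal.Quotient.mkₐ K I (X ⟨s.1, s.2.1⟩)) ⊗ₜ[K]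
      (Ideal.Quotient.mkₐ K J (X ⟨s.1, s.2.2⟩)) := by
  simp [psiTFP, phiS]

lemma mono_mem_range (dx dy : Fin d → ℕ)
    (I : Ideal (MvPolynomial (Σ α : Fin d, Fin (dx α)) K))
    (J : Ideal (MvPolynomial (Σ α : Fin d, Fin (dy α)) K))
    (k : ℕ) : ∀ (m : (Σ α : Fin d, Fin (dx α)) →₀ ℕ) (n : (Σ α : Fin d, Fin (dy α)) →₀ ℕ)
    (_ : m.degree = k) (_ : ∀ α, cnt m α = cnt n α),
    (Ideal.Quotient.mkₐ K I (monomial m 1)) ⊗ₜ[K] (Ideal.Quotient.mkₐ K J (monomial n 1))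
      ∈ (psiTFP K dx dy I J).range := by
  induction k with
  | zero =>
    intro m n hm hc
    have hm0 : m = 0 := (Finsupp.degree_eq_zero_iff m).mp hm
    subst hm0
    have hn0 : n = 0 := by
      ext ⟨α, β⟩
      have h1 := hc α
      have h2 : cnt (0 : (Σ α : Fin d, Fin (dx α)) →₀ ℕ) α = 0 := by simp [cnt]
      rw [h2] at h1
      have h3 := (Finset.sum_eq_zero_iff.mp h1.symm) β (Finset.mem_univ _)
      simpa using h3
    subst hn0
    have : (monomial (0 : (Σ α : Fin d, Fin (dx α)) →₀ ℕ) (1 : K)) = 1 := rfl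
    rw [this]
    have : (monomial (0 : (Σ α : Fin d, Fin (dy α)) →₀ ℕ) (1 : K)) = 1 := rfl
    rw [this, map_one, map_one]
    exact one_mem (psiTFP K dx dy I J).range
  | succ k ih =>
    intro m n hm hc
    have hmne : m ≠ 0 := by
      rintro rfl
      simp at hm
    obtain ⟨⟨α, β⟩, hs⟩ := Finsupp.ne_iff.mp hmne
    simp only [Finsupp.coe_zero, Pi.zero_apply] at hs
    have hle : Finsupp.single (⟨α, β⟩ : Σ α : Fin d, Fin (dx α)) 1 ≤ m := by
      rw [Finsupp.single_le_iff]; omega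
    obtain ⟨m', rfl⟩ := exists_add_of_le hle
    have hcα := hc α
    have hex : ∃ γ, n ⟨α, γ⟩ ≠ 0 := by
      by_contra! hcon
      have : cnt n α = 0 := Finset.sum_eq_zero (fun γ _ => hcon γ)
      rw [cnt_add, cnt_single] at hcα
      simp [this] at hcα
    obtain ⟨γ, hγ⟩ := hex
    have hle' : Finsupp.single (⟨α, γ⟩ : Σ α : Fin d, Fin (dy α)) 1 ≤ n := by
      rw [Finsupp.single_le_iff]; omega
    obtain ⟨n', rfl⟩ := exists_add_of_le hle'
    have := ih m' n' (by
      rw [map_add, Finsupp.degree_single] at hm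
      omega) (by
      intro α'
      have := hc α'
      rw [cnt_add, cnt_add, cnt_single, cnt_single] at this
      simpa using this)
    have h2 : psiTFP K dx dy I J (X ⟨α, β, γ⟩) ∈ (psiTFP K dx dy I J).range := ⟨_, rfl⟩
    have h3 := mul_mem h2 this
    rw [psi_X, Algebra.TensorProduct.tmul_mul_tmul, ← map_mul, ← map_mul] at h3
    simpa [X, monomial_mul] using h3

lemma psi_monomial (a : Fin d → Fin h → ℤ) (dx dy : Fin d → ℕ)
    (I : Ideal (MvPolynomial (Σ α : Fin d, Fin (dx α)) K))
    (J : Ideal (MvPolynomial (Σ α : Fin d, Fin (dy α)) K))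
    (u : (Σ α : Fin d, Fin (dx α) × Fin (dy α)) →₀ ℕ) :
    ∃ (m : (Σ α : Fin d, Fin (dx α)) →₀ ℕ) (n : (Σ α : Fin d, Fin (dy α)) →₀ ℕ),
      degV a m = degV a n ∧ psiTFP K dx dy I J (monomial u 1) =
      (Ideal.Quotient.mkₐ K I (monomial m 1)) ⊗ₜ[K]
        (Ideal.Quotient.mkₐ K J (monomial n 1)) := by
  induction u using Finsupp.induction_linear with
  | zero =>
    refine ⟨0, 0, by simp [degV], ?_⟩
    simp only [monomial_zero', map_one]
    exact (psiTFP K dx dy I J).toRingHom.map_one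
  | add u v ihu ihv =>
    obtain ⟨m, n, hmn, hu⟩ := ihu
    obtain ⟨m', n', hmn', hv⟩ := ihv
    refine ⟨m + m', n + n', ?_, ?_⟩
    · rw [degV_add, degV_add, hmn, hmn']
    · have h1 : (monomial (u + v) (1 : K)) = monomial u 1 * monomial v 1 := by
        simp [monomial_mul]
      rw [h1, map_mul, hu, hv, Algebra.TensorProduct.tmul_mul_tmul, ← map_mul, ← map_mul]
      simp [monomial_mul]
  | single s k =>
    refine ⟨k • Finsupp.single ⟨s.1, s.2.1⟩ 1, k • Finsupp.single ⟨s.1, s.2.2⟩ 1, ?_, ?_⟩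
    · induction k with
      | zero => simp [degV]
      | succ k ih => rw [succ_nsmul, succ_nsmul, degV_add, degV_add, ih, degV_single, degV_single]
    · have hpow : psiTFP K dx dy I J (X s ^ k) = psiTFP K dx dy I J (X s) ^ k :=
        (psiTFP K dx dy I J).toRingHom.map_pow _ _
      rw [← X_pow_eq_monomial, hpow, psi_X, Algebra.TensorProduct.tmul_pow, ← map_pow,
        ← map_pow, X_pow_eq_monomial, X_pow_eq_monomial]
      simp

lemma range_eq_segre (a : Fin d → Fin h → ℤ) (dx dy : Fin d → ℕ)
    (hker : ∀ c : Fin d → ℤ, (∑ α, c α • a α) = 0 → c = 0)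
    (I : Ideal (MvPolynomial (Σ α : Fin d, Fin (dx α)) K))
    (J : Ideal (MvPolynomial (Σ α : Fin d, Fin (dy α)) K)) :
    Subalgebra.toSubmodule (psiTFP K dx dy I J).range = SegreQuot a I J := by
  apply le_antisymm
  · rintro _ ⟨p, rfl⟩
    change psiTFP K dx dy I J p ∈ _
    induction p using MvPolynomial.induction_on' with
    | monomial u c =>
      obtain ⟨m, n, hmn, hu⟩ := psi_monomial a dx dy I J u
      have : (monomial u c : MvPolynomial _ K) = c • monomial u 1 := by
        simp [smul_monomial]
      rw [this, map_smul, hu]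
      apply Submodule.smul_mem
      apply Submodule.mem_iSup_of_mem (degV a m)
      apply Submodule.subset_span
      exact ⟨_, ⟨_, Submodule.subset_span ⟨m, rfl, rfl⟩, rfl⟩,
        _, ⟨_, Submodule.subset_span ⟨n, hmn.symm, rfl⟩, rfl⟩, rfl⟩
    | add p q hp hq =>
      rw [map_add]
      exact add_mem hp hq
  · apply iSup_le
    intro v
    rw [Submodule.span_le]
    rintro _ ⟨_, ⟨p, hp, rfl⟩, _, ⟨q, hq, rfl⟩, rfl⟩
    change (Ideal.Quotient.mkₐ K I p) ⊗ₜ[K] (Ideal.Quotient.mkₐ K J q) ∈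
      Subalgebra.toSubmodule (psiTFP K dx dy I J).range
    induction hp using Submodule.span_induction with
    | zero => rw [map_zero, TensorProduct.zero_tmul]; exact zero_mem _
    | add x y _ _ hx hy => rw [map_add, TensorProduct.add_tmul]; exact add_mem hx hy
    | smul c x _ hx =>
      rw [map_smul, ← TensorProduct.smul_tmul']; exact Submodule.smul_mem _ _ hx
    | mem p hp =>
      obtain ⟨m, hm, rfl⟩ := hp
      induction hq using Submodule.span_induction with
      | zero => rw [map_zero, TensorProduct.tmul_zero]; exact zero_mem _
      | add x y _ _ hx hy => rw [map_add, TensorProduct.tmul_add]; exact add_mem hx hy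
      | smul c x _ hx =>
        rw [map_smul, TensorProduct.tmul_smul]; exact Submodule.smul_mem _ _ hx
      | mem q hq =>
        obtain ⟨n, hn, rfl⟩ := hq
        exact mono_mem_range dx dy I J _ m n rfl
          (cnt_eq_of_degV_eq a hker m n (hm.trans hn.symm))

/-- If the configuration `a` has trivial integer kernel (codimension 0), then the
toric fiber product ring `K[z]/(I ×_A J)` is isomorphic to the Segre product
`R ∘_{ℕ𝒜} S`. -/
theorem tfp_iso_segre_of_codim_zero (a : Fin d → Fin h → ℤ) (dx dy : Fin d → ℕ)
    (hker : ∀ c : Fin d → ℤ, (∑ α, c α • a α) = 0 → c = 0)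
    (I : Ideal (MvPolynomial (Σ α : Fin d, Fin (dx α)) K))
    (J : Ideal (MvPolynomial (Σ α : Fin d, Fin (dy α)) K))
    (hI : IsHomogA a I) (hJ : IsHomogA a J) :
    ∃ T : Subalgebra K ((MvPolynomial (Σ α : Fin d, Fin (dx α)) K ⧸ I) ⊗[K]
        (MvPolynomial (Σ α : Fin d, Fin (dy α)) K ⧸ J)),
      Subalgebra.toSubmodule T = SegreQuot a I J ∧
      Nonempty ((MvPolynomial (Σ α : Fin d, Fin (dx α) × Fin (dy α)) K ⧸
        TFP K dx dy I J) ≃ₐ[K] T) := by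
  exact ⟨(psiTFP K dx dy I J).range, range_eq_segre a dx dy hker I J,
    ⟨Ideal.quotientKerEquivRange (psiTFP K dx dy I J)⟩⟩
end
end

section
/- Suppose the columns of A are pairwise distinct and the all-ones vector lies in the row space of A. Then K[z]/(I ×_A J), viewed inside R ∘ S, equals the subring of R ∘ S generated by the elements of total degree one, i.e., by Σ_{a ∈ A} R_a ⊗ S_a. -/
open MvPolynomial
open scoped TensorProduct Classical

noncomputable section

variable {K : Type*} [Field K] {d h : ℕ}

theorem monomial_deg_one (a : Fin d → Fin h → ℤ) (dx : Fin d → ℕ)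
    (hinj : Function.Injective a)
    (hstar : ∃ w : Fin h → ℚ, ∀ α : Fin d, (∑ i, w i * (a α i : ℚ)) = 1)
    (α : Fin d) (m : (Σ α : Fin d, Fin (dx α)) →₀ ℕ)
    (hm : (∑ s, (m s : ℤ) • a s.1) = a α) :
    ∃ β : Fin (dx α), m = Finsupp.single ⟨α, β⟩ 1 := by
  obtain ⟨w, hw⟩ := hstar
  have h1 : (∑ s, (m s : ℚ)) = 1 := by
    rw [← hw α, ← hm]
    simp only [Finset.sum_apply, Pi.smul_apply, smul_eq_mul, Int.cast_sum, Int.cast_mul,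
      Int.cast_natCast, Finset.mul_sum]
    rw [Finset.sum_comm]
    refine Finset.sum_congr rfl fun s _ => ?_
    have := hw s.1
    calc (m s : ℚ) = (m s : ℚ) * ∑ i, w i * (a s.1 i : ℚ) := by rw [this, mul_one]
      _ = _ := by
        rw [Finset.mul_sum]
        exact Finset.sum_congr rfl fun i _ => by ring
  have h2 : (∑ s, m s) = 1 := by exact_mod_cast h1
  have h3 : m.sum (fun _ n => n) = 1 := by rw [Finsupp.sum_fintype _ _ (fun _ => rfl)]; exact h2
  obtain ⟨⟨α', β⟩, rfl⟩ := (Finsupp.sum_eq_one_iff m).1 h3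
  have h4 : a α' = a α := by
    rw [← hm, Finset.sum_eq_single (⟨α', β⟩ : Σ α : Fin d, Fin (dx α))]
    · simp
    · intro b _ hb
      simp [Finsupp.single_eq_of_ne hb]
    · simp
  obtain rfl := hinj h4
  exact ⟨β, rfl⟩

theorem quotComp_le_span (a : Fin d → Fin h → ℤ) (dx : Fin d → ℕ)
    (hinj : Function.Injective a)
    (hstar : ∃ w : Fin h → ℚ, ∀ α : Fin d, (∑ i, w i * (a α i : ℚ)) = 1)
    (I : Ideal (MvPolynomial (Σ α : Fin d, Fin (dx α)) K)) (α : Fin d) :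
    quotComp a (a α) I ≤
      Submodule.span K (Set.range fun β : Fin (dx α) => Ideal.Quotient.mk I (X ⟨α, β⟩)) := by
  unfold quotComp
  rw [Submodule.map_span, Submodule.span_le]
  rintro _ ⟨_, ⟨m, hm, rfl⟩, rfl⟩
  obtain ⟨β, rfl⟩ := monomial_deg_one a dx hinj hstar α m hm
  exact Submodule.subset_span ⟨β, rfl⟩

theorem X_mem_quotComp (a : Fin d → Fin h → ℤ) (dx : Fin d → ℕ)
    (I : Ideal (MvPolynomial (Σ α : Fin d, Fin (dx α)) K)) (α : Fin d) (β : Fin (dx α)) :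
    Ideal.Quotient.mk I (X ⟨α, β⟩) ∈ quotComp a (a α) I := by
  refine ⟨X ⟨α, β⟩, Submodule.subset_span ⟨Finsupp.single ⟨α, β⟩ 1, ?_, rfl⟩, rfl⟩
  rw [Finset.sum_eq_single (⟨α, β⟩ : Σ α : Fin d, Fin (dx α))]
  · simp
  · intro b _ hb
    simp [Finsupp.single_eq_of_ne hb]
  · simp

/-- If the columns of `A` are pairwise distinct and the all-ones vector lies in the
row space of `A` (condition (∗)), then the image of `K[z]/(I ×_A J)` in `R ∘ S`,
i.e. the subalgebra generated by the simple generators `x̄^α_β ⊗ ȳ^α_γ`, equals the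
subalgebra of `R ∘ S` generated by the elements of total degree one, i.e. by
`Σ_{α} R_{a_α} ⊗ S_{a_α}`. -/
theorem tfp_eq_degree_one_subring (a : Fin d → Fin h → ℤ) (dx dy : Fin d → ℕ)
    (hinj : Function.Injective a)
    (hstar : ∃ w : Fin h → ℚ, ∀ α : Fin d, (∑ i, w i * (a α i : ℚ)) = 1)
    (I : Ideal (MvPolynomial (Σ α : Fin d, Fin (dx α)) K))
    (J : Ideal (MvPolynomial (Σ α : Fin d, Fin (dy α)) K))
    (hI : IsHomogA a I) (hJ : IsHomogA a J) :
    Algebra.adjoin K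
        {w | ∃ (α : Fin d) (β : Fin (dx α)) (γ : Fin (dy α)),
          w = (Ideal.Quotient.mk I (X ⟨α, β⟩)) ⊗ₜ[K] (Ideal.Quotient.mk J (X ⟨α, γ⟩))} =
      Algebra.adjoin K
        {x | ∃ α : Fin d, ∃ r ∈ quotComp a (a α) I, ∃ s ∈ quotComp a (a α) J,
          x = r ⊗ₜ[K] s} := by
  apply le_antisymm
  · apply Algebra.adjoin_mono
    rintro _ ⟨α, β, γ, rfl⟩
    exact ⟨α, _, X_mem_quotComp a dx I α β, _, X_mem_quotComp a dy J α γ, rfl⟩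
  · apply Algebra.adjoin_le
    rintro _ ⟨α, r, hr, s, hs, rfl⟩
    have hr' := quotComp_le_span a dx hinj hstar I α hr
    have hs' := quotComp_le_span a dy hinj hstar J α hs
    clear hr hs
    rw [SetLike.mem_coe]
    induction hr' using Submodule.span_induction with
    | zero => rw [TensorProduct.zero_tmul]; exact zero_mem _
    | add x y _ _ hx hy => rw [TensorProduct.add_tmul]; exact add_mem hx hy
    | smul c x _ hx => rw [← TensorProduct.smul_tmul']; exact Subalgebra.smul_mem _ hx c
    | mem x hx =>
      obtain ⟨β, rfl⟩ := hx
      induction hs' using Submodule.span_induction with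
      | zero => rw [TensorProduct.tmul_zero]; exact zero_mem _
      | add x y _ _ hx hy => rw [TensorProduct.tmul_add]; exact add_mem hx hy
      | smul c x _ hx => rw [TensorProduct.tmul_smul]; exact Subalgebra.smul_mem _ hx c
      | mem y hy =>
        obtain ⟨γ, rfl⟩ := hy
        exact Algebra.subset_adjoin ⟨α, β, γ, rfl⟩
end
end

section
/- For any Segre product R ∘_{NA} S of NA-graded affine K-algebras R ≅ K[x]/I and S ≅ K[y]/J, there exist a vector configuration A′ with NA′ = NA and NA′-homogeneous ideals I′ ⊆ K[x′], J′ ⊆ K[y′] such that K[x′]/I′ ≅ R, K[y′]/J′ ≅ S, and R ∘_{NA} S ≅ K[z′]/(I′ ×_{A′} J′). -/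
open MvPolynomial
open scoped TensorProduct Classical

noncomputable section

variable {K : Type*} [Field K] {d h : ℕ}

/-- The degree map as an additive homomorphism. -/
def degA (a : Fin d → Fin h → ℤ) (dx : Fin d → ℕ) :
    ((Σ α : Fin d, Fin (dx α)) →₀ ℕ) →+ (Fin h → ℤ) where
  toFun m := ∑ s, (m s : ℤ) • a s.1
  map_zero' := by simp
  map_add' m n := by simp [add_smul, Finset.sum_add_distrib]

lemma degA_apply (a : Fin d → Fin h → ℤ) (dx : Fin d → ℕ) (m : (Σ α : Fin d, Fin (dx α)) →₀ ℕ) :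
    degA a dx m = ∑ s, (m s : ℤ) • a s.1 := rfl

lemma degA_single (a : Fin d → Fin h → ℤ) (dx : Fin d → ℕ) (s : Σ α : Fin d, Fin (dx α)) :
    degA a dx (Finsupp.single s 1) = a s.1 := by
  rw [degA_apply, Finset.sum_eq_single s]
  · simp
  · intro b _ hb
    simp [hb.symm]
  · simp

lemma degA_mem (a : Fin d → Fin h → ℤ) (dx : Fin d → ℕ) (m : (Σ α : Fin d, Fin (dx α)) →₀ ℕ) :
    degA a dx m ∈ AddSubmonoid.closure (Set.range a) := by
  rw [degA_apply]
  refine sum_mem fun s _ => ?_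
  rw [natCast_zsmul]
  exact nsmul_mem (AddSubmonoid.subset_closure (Set.mem_range_self s.1)) _

lemma coeff_homCompA (a : Fin d → Fin h → ℤ) {dx : Fin d → ℕ} (v : Fin h → ℤ)
    (p : MvPolynomial (Σ α : Fin d, Fin (dx α)) K) (m : (Σ α : Fin d, Fin (dx α)) →₀ ℕ) :
    coeff m (homCompA a v p) = if degA a dx m = v then coeff m p else 0 := by
  unfold homCompA
  rw [coeff_sum]
  simp only [coeff_monomial]
  rw [Finset.sum_ite_eq']
  have hiff : m ∈ p.support.filter (fun m => (∑ s, (m s : ℤ) • a s.1) = v) ↔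
      coeff m p ≠ 0 ∧ degA a dx m = v := by
    rw [Finset.mem_filter, mem_support_iff, degA_apply]
  by_cases h1 : degA a dx m = v
  · by_cases h3 : coeff m p = 0
    · rw [h3, ite_self, ite_self]
    · rw [if_pos (hiff.2 ⟨h3, h1⟩), if_pos h1]
  · rw [if_neg (fun hm => h1 (hiff.1 hm).2), if_neg h1]

lemma homCompA_add (a : Fin d → Fin h → ℤ) {dx : Fin d → ℕ} (v : Fin h → ℤ)
    (p q : MvPolynomial (Σ α : Fin d, Fin (dx α)) K) :
    homCompA a v (p + q) = homCompA a v p + homCompA a v q := by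
  ext m
  simp only [coeff_add, coeff_homCompA]
  split_ifs <;> simp

lemma homCompA_monomial (a : Fin d → Fin h → ℤ) {dx : Fin d → ℕ} (v : Fin h → ℤ)
    (m : (Σ α : Fin d, Fin (dx α)) →₀ ℕ) (c : K) :
    homCompA a v (monomial m c) = if degA a dx m = v then monomial m c else 0 := by
  ext n
  rw [coeff_homCompA]
  by_cases hmn : m = n
  · subst hmn
    split_ifs <;> simp
  · split_ifs <;> simp [coeff_monomial, hmn]

/-- The monomial substitution attached to a family of exponents. -/
def expHom (K : Type*) [Field K] {σ τ : Type*} (e : σ → τ →₀ ℕ) :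
    MvPolynomial σ K →ₐ[K] MvPolynomial τ K :=
  aeval (fun s => monomial (e s) 1)

lemma expHom_X {σ τ : Type*} (e : σ → τ →₀ ℕ) (s : σ) :
    expHom K e (X s) = monomial (e s) 1 := by
  simp [expHom]

lemma expHom_monomial {σ τ : Type*} (e : σ → τ →₀ ℕ) (m : σ →₀ ℕ) (c : K) :
    expHom K e (monomial m c) = monomial (m.sum fun s k => k • e s) c := by
  rw [monomial_finsupp_sum_index, expHom, aeval_monomial]
  simp [monomial_pow, algebraMap_eq]

lemma expHom_surjective {σ τ : Type*} (e : σ → τ →₀ ℕ)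
    (he : ∀ t, ∃ s, e s = Finsupp.single t 1) : Function.Surjective (expHom K e) := by
  rw [← AlgHom.range_eq_top, eq_top_iff, ← MvPolynomial.adjoin_range_X, Algebra.adjoin_le_iff]
  rintro _ ⟨t, rfl⟩
  obtain ⟨s, hs⟩ := he t
  exact ⟨X s, by simp only [AlgHom.toRingHom_eq_coe, RingHom.coe_coe]; rw [expHom_X, hs]; rfl⟩

lemma expHom_homCompA {d' : ℕ} (a : Fin d → Fin h → ℤ) (a' : Fin d' → Fin h → ℤ)
    {dx : Fin d → ℕ} {dx' : Fin d' → ℕ}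
    (e : (Σ α : Fin d', Fin (dx' α)) → (Σ α : Fin d, Fin (dx α)) →₀ ℕ)
    (he : ∀ s, degA a dx (e s) = a' s.1) (v : Fin h → ℤ)
    (p : MvPolynomial (Σ α : Fin d', Fin (dx' α)) K) :
    expHom K e (homCompA a' v p) = homCompA a v (expHom K e p) := by
  induction p using MvPolynomial.induction_on' with
  | monomial m c =>
    have : degA a dx (m.sum fun s k => k • e s) = degA a' dx' m := by
      rw [map_finsuppSum, degA_apply, Finsupp.sum_fintype _ _ (by simp)]
      simp [he]
    rw [expHom_monomial, homCompA_monomial, homCompA_monomial, this]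
    split_ifs
    · rw [expHom_monomial]
    · simp
  | add p q hp hq => rw [homCompA_add, map_add, map_add, homCompA_add, hp, hq]

lemma isHomogA_comap {d' : ℕ} (a : Fin d → Fin h → ℤ) (a' : Fin d' → Fin h → ℤ)
    {dx : Fin d → ℕ} {dx' : Fin d' → ℕ}
    (e : (Σ α : Fin d', Fin (dx' α)) → (Σ α : Fin d, Fin (dx α)) →₀ ℕ)
    (he : ∀ s, degA a dx (e s) = a' s.1)
    (I : Ideal (MvPolynomial (Σ α : Fin d, Fin (dx α)) K)) (hI : IsHomogA a I) :
    IsHomogA a' (RingHom.ker ((Ideal.Quotient.mkₐ K I).comp (expHom K e))) := by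
  intro p hp v
  rw [RingHom.mem_ker, AlgHom.comp_apply, Ideal.Quotient.mkₐ_eq_mk,
    Ideal.Quotient.eq_zero_iff_mem] at hp ⊢
  rw [expHom_homCompA a a' e he]
  exact hI _ hp v

/-- The class of a pair of monomials in `R ⊗ S`. -/
def thetaS {σ τ : Type*} (I : Ideal (MvPolynomial σ K)) (J : Ideal (MvPolynomial τ K))
    (m : (σ →₀ ℕ) × (τ →₀ ℕ)) : (MvPolynomial σ K ⧸ I) ⊗[K] (MvPolynomial τ K ⧸ J) :=
  (Ideal.Quotient.mkₐ K I (monomial m.1 1)) ⊗ₜ[K] (Ideal.Quotient.mkₐ K J (monomial m.2 1))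

lemma thetaS_zero {σ τ : Type*} (I : Ideal (MvPolynomial σ K)) (J : Ideal (MvPolynomial τ K)) :
    thetaS I J 0 = 1 := by
  simp only [thetaS, Prod.fst_zero, Prod.snd_zero]
  rw [show (monomial (0 : σ →₀ ℕ) (1 : K)) = 1 from rfl,
    show (monomial (0 : τ →₀ ℕ) (1 : K)) = 1 from rfl, map_one, map_one]
  rfl

lemma thetaS_add {σ τ : Type*} (I : Ideal (MvPolynomial σ K)) (J : Ideal (MvPolynomial τ K))
    (m n : (σ →₀ ℕ) × (τ →₀ ℕ)) :
    thetaS I J (m + n) = thetaS I J m * thetaS I J n := by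
  simp only [thetaS, Prod.fst_add, Prod.snd_add, Algebra.TensorProduct.tmul_mul_tmul,
    ← map_mul, monomial_mul, one_mul]

/-- Pairs of exponents of equal degree. -/
def eqDeg (a : Fin d → Fin h → ℤ) (dx dy : Fin d → ℕ) :
    AddSubmonoid (((Σ α : Fin d, Fin (dx α)) →₀ ℕ) × ((Σ α : Fin d, Fin (dy α)) →₀ ℕ)) :=
  AddMonoidHom.eqLocusM ((degA a dx).comp (AddMonoidHom.fst _ _))
    ((degA a dy).comp (AddMonoidHom.snd _ _))

lemma mem_eqDeg {a : Fin d → Fin h → ℤ} {dx dy : Fin d → ℕ}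
    {m : ((Σ α : Fin d, Fin (dx α)) →₀ ℕ) × ((Σ α : Fin d, Fin (dy α)) →₀ ℕ)} :
    m ∈ eqDeg a dx dy ↔ degA a dx m.1 = degA a dy m.2 := Iff.rfl

lemma eqDeg_fg (a : Fin d → Fin h → ℤ) (dx dy : Fin d → ℕ) : (eqDeg a dx dy).FG :=
  AddSubmonoid.fg_eqLocusM _ _

lemma segreQuot_eq (a : Fin d → Fin h → ℤ) {dx dy : Fin d → ℕ}
    (I : Ideal (MvPolynomial (Σ α : Fin d, Fin (dx α)) K))
    (J : Ideal (MvPolynomial (Σ α : Fin d, Fin (dy α)) K)) :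
    SegreQuot a I J = Submodule.span K (thetaS I J '' (eqDeg a dx dy : Set _)) := by
  apply le_antisymm
  · refine iSup_le fun v => Submodule.span_le.2 ?_
    rintro _ ⟨r, hr, s, hs, rfl⟩
    have hrs := Submodule.apply_mem_map₂ (TensorProduct.mk K _ _) hr hs
    rw [quotComp, quotComp, Submodule.map_span, Submodule.map_span,
      Submodule.map₂_span_span] at hrs
    refine Submodule.span_mono ?_ hrs
    rintro _ ⟨_, ⟨_, ⟨m, hm, rfl⟩, rfl⟩, _, ⟨_, ⟨n, hn, rfl⟩, rfl⟩, rfl⟩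
    exact ⟨(m, n), mem_eqDeg.2 (hm.trans hn.symm), rfl⟩
  · refine Submodule.span_le.2 ?_
    rintro _ ⟨⟨m, n⟩, hmn, rfl⟩
    refine Submodule.mem_iSup_of_mem (degA a dx m) (Submodule.subset_span ?_)
    refine ⟨_, Submodule.mem_map_of_mem (Submodule.subset_span ⟨m, rfl, rfl⟩), _,
      Submodule.mem_map_of_mem (Submodule.subset_span ⟨n, ?_, rfl⟩), rfl⟩
    exact (mem_eqDeg.1 hmn).symm

/-- The core: given exponent families with the right properties, conclude. -/
lemma segre_core {d' : ℕ} (a : Fin d → Fin h → ℤ) (dx dy : Fin d → ℕ)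
    (I : Ideal (MvPolynomial (Σ α : Fin d, Fin (dx α)) K))
    (J : Ideal (MvPolynomial (Σ α : Fin d, Fin (dy α)) K))
    (hI : IsHomogA a I) (hJ : IsHomogA a J)
    (a' : Fin d' → Fin h → ℤ) (dx' dy' : Fin d' → ℕ)
    (ex : (Σ α : Fin d', Fin (dx' α)) → (Σ α : Fin d, Fin (dx α)) →₀ ℕ)
    (ey : (Σ α : Fin d', Fin (dy' α)) → (Σ α : Fin d, Fin (dy α)) →₀ ℕ)
    (hex : ∀ s, degA a dx (ex s) = a' s.1) (hey : ∀ s, degA a dy (ey s) = a' s.1)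
    (sx : ∀ t, ∃ s, ex s = Finsupp.single t 1) (sy : ∀ t, ∃ s, ey s = Finsupp.single t 1)
    (G : Set (((Σ α : Fin d, Fin (dx α)) →₀ ℕ) × ((Σ α : Fin d, Fin (dy α)) →₀ ℕ)))
    (hG : AddSubmonoid.closure G = eqDeg a dx dy)
    (hGe : ∀ g ∈ G, ∃ α β γ, ex ⟨α, β⟩ = g.1 ∧ ey ⟨α, γ⟩ = g.2) :
    ∃ (I' : Ideal (MvPolynomial (Σ α : Fin d', Fin (dx' α)) K))
      (J' : Ideal (MvPolynomial (Σ α : Fin d', Fin (dy' α)) K)),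
      IsHomogA a' I' ∧ IsHomogA a' J' ∧
      Nonempty ((MvPolynomial (Σ α : Fin d', Fin (dx' α)) K ⧸ I') ≃ₐ[K]
        (MvPolynomial (Σ α : Fin d, Fin (dx α)) K ⧸ I)) ∧
      Nonempty ((MvPolynomial (Σ α : Fin d', Fin (dy' α)) K ⧸ J') ≃ₐ[K]
        (MvPolynomial (Σ α : Fin d, Fin (dy α)) K ⧸ J)) ∧
      ∃ T : Subalgebra K ((MvPolynomial (Σ α : Fin d, Fin (dx α)) K ⧸ I) ⊗[K]
          (MvPolynomial (Σ α : Fin d, Fin (dy α)) K ⧸ J)),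
        Subalgebra.toSubmodule T = SegreQuot a I J ∧
        Nonempty ((MvPolynomial (Σ α : Fin d', Fin (dx' α) × Fin (dy' α)) K ⧸
          TFP K dx' dy' I' J') ≃ₐ[K] T) := by
  have hfx : Function.Surjective ((Ideal.Quotient.mkₐ K I).comp (expHom K ex)) :=
    (Ideal.Quotient.mkₐ_surjective K I).comp (expHom_surjective ex sx)
  have hfy : Function.Surjective ((Ideal.Quotient.mkₐ K J).comp (expHom K ey)) :=
    (Ideal.Quotient.mkₐ_surjective K J).comp (expHom_surjective ey sy)
  let eR := Ideal.quotientKerAlgEquivOfSurjective hfx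
  let eS := Ideal.quotientKerAlgEquivOfSurjective hfy
  refine ⟨_, _, isHomogA_comap a a' ex hex I hI, isHomogA_comap a a' ey hey J hJ,
    ⟨eR⟩, ⟨eS⟩, ?_⟩
  set I' := RingHom.ker ((Ideal.Quotient.mkₐ K I).comp (expHom K ex)) with hI'
  set J' := RingHom.ker ((Ideal.Quotient.mkₐ K J).comp (expHom K ey)) with hJ'
  let g : (Σ α : Fin d', Fin (dx' α) × Fin (dy' α)) →
      (MvPolynomial (Σ α : Fin d, Fin (dx α)) K ⧸ I) ⊗[K]
          (MvPolynomial (Σ α : Fin d, Fin (dy α)) K ⧸ J) :=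
    fun s => thetaS I J (ex ⟨s.1, s.2.1⟩, ey ⟨s.1, s.2.2⟩)
  let Ψ : MvPolynomial (Σ α : Fin d', Fin (dx' α) × Fin (dy' α)) K →ₐ[K] _ := aeval (R := K) g
  have hΨ : Ψ = (Algebra.TensorProduct.congr eR eS).toAlgHom.comp (psiTFP K dx' dy' I' J') := by
    apply MvPolynomial.algHom_ext
    intro s
    have h1 : eR (Ideal.Quotient.mk I' (X ⟨s.1, s.2.1⟩)) =
        Ideal.Quotient.mk I (monomial (ex ⟨s.1, s.2.1⟩) 1) := by
      rw [← expHom_X]; rfl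
    have h2 : eS (Ideal.Quotient.mk J' (X ⟨s.1, s.2.2⟩)) =
        Ideal.Quotient.mk J (monomial (ey ⟨s.1, s.2.2⟩) 1) := by
      rw [← expHom_X]; rfl
    simp [Ψ, g, thetaS, psiTFP, phiS, h1, h2]
  have hker : TFP K dx' dy' I' J' = RingHom.ker Ψ := by
    ext p
    simp only [TFP, RingHom.mem_ker, hΨ]
    exact (map_eq_zero_iff _ (Algebra.TensorProduct.congr eR eS).injective).symm
  refine ⟨Ψ.range, ?_, ?_⟩
  · have hr : Ψ.range = Algebra.adjoin K (Set.range g) :=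
      (Algebra.adjoin_range_eq_range_aeval K g).symm
    rw [segreQuot_eq, hr, Algebra.adjoin_eq_span]
    congr 1
    apply Set.Subset.antisymm
    · intro x hx
      induction hx using Submonoid.closure_induction with
      | mem x hx =>
        obtain ⟨s, rfl⟩ := hx
        exact ⟨_, mem_eqDeg.2 ((hex ⟨s.1, s.2.1⟩).trans (hey ⟨s.1, s.2.2⟩).symm), rfl⟩
      | one => exact ⟨0, zero_mem _, thetaS_zero I J⟩
      | mul x y _ _ hx hy =>
        obtain ⟨m, hm, rfl⟩ := hx
        obtain ⟨n, hn, rfl⟩ := hy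
        exact ⟨m + n, add_mem hm hn, thetaS_add I J m n⟩
    · rintro _ ⟨m, hm, rfl⟩
      rw [← hG] at hm
      induction hm using AddSubmonoid.closure_induction with
      | mem m hm =>
        obtain ⟨α, β, γ, h1, h2⟩ := hGe m hm
        refine Submonoid.subset_closure ⟨⟨α, β, γ⟩, ?_⟩
        simp only [g, h1, h2]
      | zero => rw [thetaS_zero]; exact one_mem _
      | add m n _ _ hm hn => rw [thetaS_add]; exact mul_mem hm hn
  · exact ⟨(Ideal.quotientEquivAlgOfEq K hker).trans (Ideal.quotientKerEquivRange Ψ)⟩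

/-- Every Segre product can be presented as a toric fiber product: for any
`ℕ𝒜`-homogeneous presentations `R = K[x]/I`, `S = K[y]/J`, there are a configuration
`a'` generating the same affine monoid and `ℕ𝒜'`-homogeneous ideals `I'`, `J'`
presenting `R` and `S` such that `R ∘_{ℕ𝒜} S ≅ K[z']/(I' ×_{A'} J')`. -/
theorem segre_is_a_tfp (a : Fin d → Fin h → ℤ) (dx dy : Fin d → ℕ)
    (I : Ideal (MvPolynomial (Σ α : Fin d, Fin (dx α)) K))
    (J : Ideal (MvPolynomial (Σ α : Fin d, Fin (dy α)) K))
    (hI : IsHomogA a I) (hJ : IsHomogA a J) :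
    ∃ (d' : ℕ) (a' : Fin d' → Fin h → ℤ) (dx' dy' : Fin d' → ℕ)
      (I' : Ideal (MvPolynomial (Σ α : Fin d', Fin (dx' α)) K))
      (J' : Ideal (MvPolynomial (Σ α : Fin d', Fin (dy' α)) K)),
      AddSubmonoid.closure (Set.range a') = AddSubmonoid.closure (Set.range a) ∧
      IsHomogA a' I' ∧ IsHomogA a' J' ∧
      Nonempty ((MvPolynomial (Σ α : Fin d', Fin (dx' α)) K ⧸ I') ≃ₐ[K]
        (MvPolynomial (Σ α : Fin d, Fin (dx α)) K ⧸ I)) ∧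
      Nonempty ((MvPolynomial (Σ α : Fin d', Fin (dy' α)) K ⧸ J') ≃ₐ[K]
        (MvPolynomial (Σ α : Fin d, Fin (dy α)) K ⧸ J)) ∧
      ∃ T : Subalgebra K ((MvPolynomial (Σ α : Fin d, Fin (dx α)) K ⧸ I) ⊗[K]
          (MvPolynomial (Σ α : Fin d, Fin (dy α)) K ⧸ J)),
        Subalgebra.toSubmodule T = SegreQuot a I J ∧
        Nonempty ((MvPolynomial (Σ α : Fin d', Fin (dx' α) × Fin (dy' α)) K ⧸
          TFP K dx' dy' I' J') ≃ₐ[K] T) := by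
  obtain ⟨G, hG⟩ := eqDeg_fg a dx dy
  let e : Fin (Fintype.card (Fin d ⊕ G)) ≃ Fin d ⊕ G := (Fintype.equivFin _).symm
  let px : Fin d ⊕ G → Σ n : ℕ, Fin n → (Σ α : Fin d, Fin (dx α)) →₀ ℕ :=
    Sum.elim (fun i => ⟨dx i, fun b => Finsupp.single ⟨i, b⟩ 1⟩) (fun g => ⟨1, fun _ => g.1.1⟩)
  let py : Fin d ⊕ G → Σ n : ℕ, Fin n → (Σ α : Fin d, Fin (dy α)) →₀ ℕ :=
    Sum.elim (fun i => ⟨dy i, fun b => Finsupp.single ⟨i, b⟩ 1⟩) (fun g => ⟨1, fun _ => g.1.2⟩)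
  let a₀ : Fin d ⊕ G → Fin h → ℤ := Sum.elim a (fun g => degA a dx g.1.1)
  have hx : ∀ i b, degA a dx ((px i).2 b) = a₀ i := by
    rintro (i | g) b
    · exact degA_single a dx _
    · rfl
  have hy : ∀ i b, degA a dy ((py i).2 b) = a₀ i := by
    rintro (i | g) b
    · exact degA_single a dy _
    · have : g.1 ∈ eqDeg a dx dy := hG ▸ AddSubmonoid.subset_closure g.2
      exact (mem_eqDeg.1 this).symm
  have key := segre_core a dx dy I J hI hJ (fun α => a₀ (e α)) (fun α => (px (e α)).1)
    (fun α => (py (e α)).1) (fun s => (px (e s.1)).2 s.2) (fun s => (py (e s.1)).2 s.2)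
    (fun s => hx _ _) (fun s => hy _ _) ?_ ?_ G hG ?_
  · obtain ⟨I', J', hh⟩ := key
    refine ⟨_, _, _, _, I', J', ?_, hh⟩
    apply le_antisymm
    · rw [AddSubmonoid.closure_le]
      rintro _ ⟨α, rfl⟩
      show a₀ (e α) ∈ _
      rcases e α with i | g
      · exact AddSubmonoid.subset_closure ⟨i, rfl⟩
      · exact degA_mem a dx _
    · apply AddSubmonoid.closure_mono
      rintro _ ⟨i, rfl⟩
      exact ⟨e.symm (Sum.inl i), by simp [a₀]⟩
  · rintro ⟨i, b⟩
    have : ∃ β, (px (e (e.symm (Sum.inl i)))).2 β = Finsupp.single ⟨i, b⟩ 1 := by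
      rw [e.apply_symm_apply]
      exact ⟨b, rfl⟩
    obtain ⟨β, hβ⟩ := this
    exact ⟨⟨_, β⟩, hβ⟩
  · rintro ⟨i, b⟩
    have : ∃ β, (py (e (e.symm (Sum.inl i)))).2 β = Finsupp.single ⟨i, b⟩ 1 := by
      rw [e.apply_symm_apply]
      exact ⟨b, rfl⟩
    obtain ⟨β, hβ⟩ := this
    exact ⟨⟨_, β⟩, hβ⟩
  · intro g hg
    have : ∃ β γ, (px (e (e.symm (Sum.inr ⟨g, hg⟩)))).2 β = g.1 ∧
        (py (e (e.symm (Sum.inr ⟨g, hg⟩)))).2 γ = g.2 := by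
      rw [e.apply_symm_apply]
      exact ⟨(0 : Fin 1), (0 : Fin 1), rfl, rfl⟩
    obtain ⟨β, γ, h1⟩ := this
    exact ⟨_, β, γ, h1⟩
end
end

section
/- For toric ideals I_B, I_C, the Graver generator M̄^g_{β,γ} is integral over the toric fiber product ring K[z]/(I_B ×_A I_C) if and only if the Graver column m^g_{β,γ} is a non-negative rational linear combination of the simple columns. -/
open MvPolynomial
open scoped TensorProduct Classical

noncomputable section

variable {K : Type*} [Field K] {d h : ℕ}

/-- The toric ideal of a vector configuration `D : σ → V`. -/
def toricIdeal (K : Type*) [Field K] {σ V : Type*} [Fintype σ] [AddCommGroup V]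
    (D : σ → V) : Ideal (MvPolynomial σ K) :=
  Ideal.span {p | ∃ u v : σ →₀ ℕ, (∑ s, ((u s : ℤ) - (v s : ℤ)) • D s) = 0 ∧
    p = monomial u 1 - monomial v 1}

/-- The integer kernel of the configuration `a`. -/
def kerA (a : Fin d → Fin h → ℤ) : Set (Fin d → ℤ) :=
  {c | ∑ α, c α • a α = 0}

/-- `u` is sign-consistent with `c` if `u α * c α ≥ 0` for all `α`. -/
def SignConsistent (u c : Fin d → ℤ) : Prop := ∀ α, 0 ≤ u α * c α

/-- A Graver basis element: a primitive element of the kernel. -/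
def IsPrimitive (a : Fin d → Fin h → ℤ) (c : Fin d → ℤ) : Prop :=
  c ∈ kerA a ∧ c ≠ 0 ∧
    ¬ ∃ u v : Fin d → ℤ, u ∈ kerA a ∧ v ∈ kerA a ∧ u ≠ 0 ∧ v ≠ 0 ∧
      SignConsistent u c ∧ SignConsistent v c ∧ c = u + v

variable {h1 h2 : ℕ} {dx dy : Fin d → ℕ}

/-- The Graver generator `M̄^g_{β,γ}`, the image of the Graver monomial in
`K[ℕB] ⊗ K[ℕC]`, encoded by the exponent vectors `mx`, `my` of its two factors. -/
def graverGen (K : Type*) [Field K] (b : (α : Fin d) → Fin (dx α) → Fin h1 → ℤ)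
    (c : (α : Fin d) → Fin (dy α) → Fin h2 → ℤ)
    (mx : (Σ α : Fin d, Fin (dx α)) →₀ ℕ) (my : (Σ α : Fin d, Fin (dy α)) →₀ ℕ) :
    (MvPolynomial (Σ α : Fin d, Fin (dx α)) K ⧸
        toricIdeal K (fun s : Σ α : Fin d, Fin (dx α) => b s.1 s.2)) ⊗[K]
      (MvPolynomial (Σ α : Fin d, Fin (dy α)) K ⧸
        toricIdeal K (fun s : Σ α : Fin d, Fin (dy α) => c s.1 s.2)) :=
  (Ideal.Quotient.mk _ (monomial mx 1)) ⊗ₜ[K] (Ideal.Quotient.mk _ (monomial my 1))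

/-- The simple column `(b^α_β ; c^α_γ)` indexed by `s = (α, (β, γ))`. -/
def simpleCol (b : (α : Fin d) → Fin (dx α) → Fin h1 → ℤ)
    (c : (α : Fin d) → Fin (dy α) → Fin h2 → ℤ)
    (s : Σ α : Fin d, Fin (dx α) × Fin (dy α)) : (Fin h1 → ℤ) × (Fin h2 → ℤ) :=
  (b s.1 s.2.1, c s.1 s.2.2)

/-- The Graver column `m^g_{β,γ} = (b^g_β ; c^g_γ)`. -/
def graverCol (b : (α : Fin d) → Fin (dx α) → Fin h1 → ℤ)
    (c : (α : Fin d) → Fin (dy α) → Fin h2 → ℤ)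
    (mx : (Σ α : Fin d, Fin (dx α)) →₀ ℕ) (my : (Σ α : Fin d, Fin (dy α)) →₀ ℕ) :
    (Fin h1 → ℤ) × (Fin h2 → ℤ) :=
  (∑ s, mx s • b s.1 s.2, ∑ s, my s • c s.1 s.2)


lemma lc_apply {σ V : Type*} [Fintype σ] [AddCommGroup V] (D : σ → V) (u : σ →₀ ℕ) :
    Finsupp.linearCombination ℕ D u = ∑ s, u s • D s := by
  rw [Finsupp.linearCombination_apply, Finsupp.sum_fintype _ _ (by simp)]

lemma toric_cond {σ V : Type*} [Fintype σ] [AddCommGroup V] (D : σ → V) (u v : σ →₀ ℕ) :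
    (∑ s, ((u s : ℤ) - (v s : ℤ)) • D s) = 0 ↔
      Finsupp.linearCombination ℕ D u = Finsupp.linearCombination ℕ D v := by
  rw [lc_apply, lc_apply, ← sub_eq_zero (a := ∑ s, u s • D s), ← Finset.sum_sub_distrib]
  simp only [sub_smul, natCast_zsmul]

lemma toric_mk_eq (K : Type*) [Field K] {σ V : Type*} [Fintype σ] [AddCommGroup V] (D : σ → V)
    (u v : σ →₀ ℕ)
    (huv : Finsupp.linearCombination ℕ D u = Finsupp.linearCombination ℕ D v) :
    Ideal.Quotient.mk (toricIdeal K D) (monomial u 1) =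
      Ideal.Quotient.mk (toricIdeal K D) (monomial v 1) := by
  rw [Ideal.Quotient.eq]
  exact Ideal.subset_span ⟨u, v, (toric_cond D u v).2 huv, rfl⟩

lemma aeval_single_monomial (K : Type*) [Field K] {σ V G : Type*} [AddCommGroup V]
    [AddCommGroup G] (D : σ → V) (f : V →+ G) (u : σ →₀ ℕ) :
    aeval (R := K) (fun s => (AddMonoidAlgebra.single (f (D s)) 1 : AddMonoidAlgebra K G))
        (monomial u 1)
      = AddMonoidAlgebra.single (f (Finsupp.linearCombination ℕ D u)) 1 := by
  rw [aeval_monomial, map_one, one_mul, Finsupp.linearCombination_apply]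
  simp [AddMonoidAlgebra.single_pow, Finsupp.sum, Finsupp.prod, AddMonoidAlgebra.prod_single]

/-- The toric quotient maps to the group algebra. -/
def toricMap (K : Type*) [Field K] {σ V G : Type*} [Fintype σ] [AddCommGroup V]
    [AddCommGroup G] (D : σ → V) (f : V →+ G) :
    (MvPolynomial σ K ⧸ toricIdeal K D) →ₐ[K] AddMonoidAlgebra K G :=
  Ideal.Quotient.liftₐ (toricIdeal K D)
    (aeval (fun s => (AddMonoidAlgebra.single (f (D s)) 1 : AddMonoidAlgebra K G))) (by
      intro p hp
      have hle : toricIdeal K D ≤ RingHom.ker (aeval (R := K)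
          (fun s => (AddMonoidAlgebra.single (f (D s)) 1 : AddMonoidAlgebra K G))) := by
        refine Ideal.span_le.2 ?_
        rintro _ ⟨u, v, huv, rfl⟩
        rw [toric_cond] at huv
        rw [SetLike.mem_coe, RingHom.mem_ker, map_sub, aeval_single_monomial,
          aeval_single_monomial, huv, sub_self]
      exact hle hp)

lemma toricMap_monomial (K : Type*) [Field K] {σ V G : Type*} [Fintype σ] [AddCommGroup V]
    [AddCommGroup G] (D : σ → V) (f : V →+ G) (u : σ →₀ ℕ) :
    toricMap K D f (Ideal.Quotient.mk _ (monomial u 1)) =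
      AddMonoidAlgebra.single (f (Finsupp.linearCombination ℕ D u)) 1 :=
  aeval_single_monomial K D f u

lemma toricMap_X (K : Type*) [Field K] {σ V G : Type*} [Fintype σ] [AddCommGroup V]
    [AddCommGroup G] (D : σ → V) (f : V →+ G) (s : σ) :
    toricMap K D f (Ideal.Quotient.mk _ (X s)) = AddMonoidAlgebra.single (f (D s)) 1 := by
  have := toricMap_monomial K D f (Finsupp.single s 1)
  change _ = _ at this
  rw [show (monomial (Finsupp.single s 1) (1 : K)) = X s from rfl] at this
  simpa [Finsupp.linearCombination_single] using this

/-- Elements of the group algebra supported on a submonoid. -/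
def supportedOn (K : Type*) [Field K] {G : Type*} [AddCommGroup G] (M : AddSubmonoid G) :
    Subalgebra K (AddMonoidAlgebra K G) where
  carrier := {f | ∀ x ∈ f.coeff.support, x ∈ M}
  add_mem' {f g} hf hg x hx := (Finset.mem_union.1 (Finsupp.support_add hx)).elim (hf x) (hg x)
  mul_mem' {f g} hf hg x hx := by
    have := AddMonoidAlgebra.support_coeff_mul_subset f g hx
    obtain ⟨y, hy, z, hz, rfl⟩ := Finset.mem_add.1 this
    exact M.add_mem (hf y hy) (hg z hz)
  algebraMap_mem' r x hx := by
    have : x = 0 := by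
      by_contra hne
      simp [AddMonoidAlgebra.coe_algebraMap, Ne.symm hne] at hx
    exact this ▸ M.zero_mem

lemma supportedOn_key (K : Type*) [Field K] {G : Type*} [AddCommGroup G] (M : AddSubmonoid G)
    (m : G) (n : ℕ) (f : Fin n → AddMonoidAlgebra K G) (hf : ∀ i, f i ∈ supportedOn K M)
    (heq : (AddMonoidAlgebra.single m 1 : AddMonoidAlgebra K G) ^ n +
      ∑ i, f i * AddMonoidAlgebra.single m 1 ^ (i : ℕ) = 0) :
    ∃ k : ℕ, 0 < k ∧ k • m ∈ M := by
  by_contra! hcon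
  have h1 := congrArg (fun x => x.coeff (n • m)) heq
  simp only [AddMonoidAlgebra.single_pow, one_pow, AddMonoidAlgebra.coeff_add,
    AddMonoidAlgebra.coeff_sum, Finsupp.add_apply, Finsupp.finsetSum_apply,
    AddMonoidAlgebra.coeff_mul_single_apply, mul_one, AddMonoidAlgebra.coeff_single,
    Finsupp.single_eq_same, AddMonoidAlgebra.coeff_zero, Finsupp.zero_apply] at h1
  rw [Finset.sum_eq_zero, add_zero] at h1
  · exact one_ne_zero h1
  · intro i _
    by_contra hne
    have hmem := hf i _ (Finsupp.mem_support_iff.2 hne)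
    refine hcon (n - i) (Nat.sub_pos_of_lt i.2) ?_
    rwa [sub_nsmul _ i.2.le]

lemma prod_tmul_prod {K R S ι : Type*} [Field K] [CommRing R] [CommRing S] [Algebra K R]
    [Algebra K S] (t : Finset ι) (x : ι → R) (y : ι → S) :
    ∏ i ∈ t, (x i ⊗ₜ[K] y i) = (∏ i ∈ t, x i) ⊗ₜ[K] (∏ i ∈ t, y i) := by
  induction t using Finset.induction_on with
  | empty => simp [Algebra.TensorProduct.one_def]
  | insert i t hi ih => simp [Finset.prod_insert hi, ih]

lemma toric_prod (K : Type*) [Field K] {σ V ι : Type*} [Fintype σ] [Fintype ι] [AddCommGroup V]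
    (D : σ → V) (p : ι → σ) (k : ι → ℕ) (N : ℕ) (u : σ →₀ ℕ)
    (hN : N • ∑ s, u s • D s = ∑ i, k i • D (p i)) :
    (Ideal.Quotient.mk (toricIdeal K D) (monomial u 1)) ^ N =
      ∏ i, (Ideal.Quotient.mk (toricIdeal K D) (X (p i))) ^ k i := by
  have e1 : (∏ i, (X (p i) : MvPolynomial σ K) ^ k i) =
      monomial (∑ i, Finsupp.single (p i) (k i)) 1 := by
    rw [monomial_sum_one]
    simp [X_pow_eq_monomial]
  simp only [← map_pow, ← map_prod]
  rw [e1, monomial_pow, one_pow]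
  apply toric_mk_eq
  rw [map_nsmul, lc_apply, hN, map_sum]
  simp

lemma monic_of_pow_mem {K R : Type*} [Field K] [CommRing R] [Algebra K R] (A : Subalgebra K R)
    (x : R) (N : ℕ) (hN : 0 < N) (hx : x ^ N ∈ A) :
    ∃ n : ℕ, 0 < n ∧ ∃ coeffs : Fin n → R, (∀ i, coeffs i ∈ A) ∧
      x ^ n + ∑ i : Fin n, coeffs i * x ^ (i : ℕ) = 0 := by
  refine ⟨N, hN, fun i => if (i : ℕ) = 0 then -(x ^ N) else 0, ?_, ?_⟩
  · intro i
    dsimp only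
    split_ifs
    · exact neg_mem hx
    · exact zero_mem _
  · rw [Finset.sum_eq_single (⟨0, hN⟩ : Fin N)]
    · simp
    · intro i _ hi
      have : (i : ℕ) ≠ 0 := fun h0 => hi (Fin.ext h0)
      simp [this]
    · simp

lemma monic_tmul {K R S ι : Type*} [Field K] [CommRing R] [CommRing S] [Algebra K R]
    [Algebra K S] [Fintype ι] (w : ι → R) (v : ι → S) (x : R) (y : S) (k : ι → ℕ) (N : ℕ)
    (hN : 0 < N) (hx : x ^ N = ∏ i, w i ^ k i) (hy : y ^ N = ∏ i, v i ^ k i) :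
    ∃ n : ℕ, 0 < n ∧ ∃ coeffs : Fin n → R ⊗[K] S,
      (∀ i, coeffs i ∈ Algebra.adjoin K {t | ∃ s, t = w s ⊗ₜ[K] v s}) ∧
      (x ⊗ₜ[K] y) ^ n + ∑ i : Fin n, coeffs i * (x ⊗ₜ[K] y) ^ (i : ℕ) = 0 := by
  refine monic_of_pow_mem _ _ N hN ?_
  rw [Algebra.TensorProduct.tmul_pow, hx, hy, ← prod_tmul_prod]
  refine prod_mem fun s _ => ?_
  rw [← Algebra.TensorProduct.tmul_pow]
  have hs : w s ⊗ₜ[K] v s ∈ Algebra.adjoin K {t | ∃ s, t = w s ⊗ₜ[K] v s} :=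
    Algebra.subset_adjoin ⟨s, rfl⟩
  exact pow_mem hs _

lemma clear_denoms {ι : Type*} [Fintype ι] (q : ι → ℚ) (hq : ∀ i, 0 ≤ q i) :
    ∃ N : ℕ, 0 < N ∧ ∃ k : ι → ℕ, ∀ i, (N : ℚ) * q i = k i := by
  refine ⟨∏ i, (q i).den, Finset.prod_pos fun i _ => (q i).pos,
    fun i => (∏ j ∈ Finset.univ.erase i, (q j).den) * (q i).num.toNat, fun i => ?_⟩
  rw [← Finset.prod_erase_mul _ _ (Finset.mem_univ i)]
  have h2 : (((q i).num.toNat : ℕ) : ℚ) = (q i).num := by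
    exact_mod_cast Int.toNat_of_nonneg (Rat.num_nonneg.2 (hq i))
  push_cast
  rw [h2, mul_assoc, Rat.den_mul_eq_num]

lemma cone_iff {ι : Type*} [Fintype ι] {h1 h2 : ℕ} (m : (Fin h1 → ℤ) × (Fin h2 → ℤ))
    (col : ι → (Fin h1 → ℤ) × (Fin h2 → ℤ)) :
    (∃ q : ι → ℚ, (∀ s, 0 ≤ q s) ∧
        (((fun i => (m.1 i : ℚ)), (fun j => (m.2 j : ℚ))) : (Fin h1 → ℚ) × (Fin h2 → ℚ)) =
          ∑ s, q s • (((fun i => ((col s).1 i : ℚ)),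
            (fun j => ((col s).2 j : ℚ))) : (Fin h1 → ℚ) × (Fin h2 → ℚ))) ↔
    ∃ N : ℕ, 0 < N ∧ ∃ k : ι → ℕ, N • m = ∑ s, k s • col s := by
  simp only [Prod.ext_iff, funext_iff, Prod.fst_sum, Prod.snd_sum, Finset.sum_apply, Prod.smul_fst,
    Prod.smul_snd, Pi.smul_apply, smul_eq_mul, nsmul_eq_mul]
  constructor
  · rintro ⟨q, hq, e1, e2⟩
    obtain ⟨N, hN, k, hk⟩ := clear_denoms q hq
    refine ⟨N, hN, k, fun i => ?_, fun i => ?_⟩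
    · have := e1 i
      have h3 : (N : ℚ) * (m.1 i : ℚ) = ∑ s, (k s : ℚ) * ((col s).1 i : ℚ) := by
        rw [this, Finset.mul_sum]
        exact Finset.sum_congr rfl fun s _ => by rw [← mul_assoc, hk]
      exact_mod_cast h3
    · have := e2 i
      have h3 : (N : ℚ) * (m.2 i : ℚ) = ∑ s, (k s : ℚ) * ((col s).2 i : ℚ) := by
        rw [this, Finset.mul_sum]
        exact Finset.sum_congr rfl fun s _ => by rw [← mul_assoc, hk]
      exact_mod_cast h3
  · rintro ⟨N, hN, k, e1, e2⟩
    have hN0 : (N : ℚ) ≠ 0 := by exact_mod_cast hN.ne'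
    refine ⟨fun s => (k s : ℚ) / N, fun s => by positivity, fun i => ?_, fun i => ?_⟩
    · have h3 : (N : ℚ) * (m.1 i : ℚ) = ∑ s, (k s : ℚ) * ((col s).1 i : ℚ) := by
        exact_mod_cast e1 i
      rw [← mul_right_inj' hN0, h3, Finset.mul_sum]
      exact Finset.sum_congr rfl fun s _ => by field_simp
    · have h3 : (N : ℚ) * (m.2 i : ℚ) = ∑ s, (k s : ℚ) * ((col s).2 i : ℚ) := by
        exact_mod_cast e2 i
      rw [← mul_right_inj' hN0, h3, Finset.mul_sum]
      exact Finset.sum_congr rfl fun s _ => by field_simp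

/-- A Graver generator `M̄^g_{β,γ}` is integral over the toric fiber product ring
`K[z]/(I_B ×_A I_C)` (the subalgebra generated by the simple generators: it satisfies
a monic polynomial equation with coefficients in that subalgebra) if and only if the
Graver column is a non-negative rational linear combination of the simple columns. -/
theorem graverGen_integral_iff (K : Type*) [Field K] {h : ℕ}
    (a : Fin d → Fin h → ℤ)
    (b : (α : Fin d) → Fin (dx α) → Fin h1 → ℤ)
    (c : (α : Fin d) → Fin (dy α) → Fin h2 → ℤ)
    (B : Matrix (Fin h) (Fin h1) ℤ) (C : Matrix (Fin h) (Fin h2) ℤ)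
    (hb : ∀ (α : Fin d) (β : Fin (dx α)), B.mulVec (b α β) = a α)
    (hc : ∀ (α : Fin d) (γ : Fin (dy α)), C.mulVec (c α γ) = a α)
    (g : Fin d → ℤ) (hg : IsPrimitive a g)
    (mx : (Σ α : Fin d, Fin (dx α)) →₀ ℕ) (my : (Σ α : Fin d, Fin (dy α)) →₀ ℕ)
    (hmx : ∀ α : Fin d, (∑ β : Fin (dx α), mx ⟨α, β⟩) = (g α).toNat)
    (hmy : ∀ α : Fin d, (∑ γ : Fin (dy α), my ⟨α, γ⟩) = (-(g α)).toNat) :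
    (∃ n : ℕ, 0 < n ∧ ∃ coeffs : Fin n → (MvPolynomial (Σ α : Fin d, Fin (dx α)) K ⧸
          toricIdeal K (fun s : Σ α : Fin d, Fin (dx α) => b s.1 s.2)) ⊗[K]
        (MvPolynomial (Σ α : Fin d, Fin (dy α)) K ⧸
          toricIdeal K (fun s : Σ α : Fin d, Fin (dy α) => c s.1 s.2)),
      (∀ i : Fin n, coeffs i ∈ Algebra.adjoin K
        {w | ∃ s : Σ α : Fin d, Fin (dx α) × Fin (dy α),
          w = (Ideal.Quotient.mk
                (toricIdeal K (fun t : Σ α : Fin d, Fin (dx α) => b t.1 t.2))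
                (X ⟨s.1, s.2.1⟩)) ⊗ₜ[K]
            (Ideal.Quotient.mk
                (toricIdeal K (fun t : Σ α : Fin d, Fin (dy α) => c t.1 t.2))
                (X ⟨s.1, s.2.2⟩))}) ∧
      (graverGen K b c mx my) ^ n +
        (∑ i : Fin n, coeffs i * (graverGen K b c mx my) ^ (i : ℕ)) = 0) ↔
      ∃ q : (Σ α : Fin d, Fin (dx α) × Fin (dy α)) → ℚ, (∀ s, 0 ≤ q s) ∧
        (((fun i => ((graverCol b c mx my).1 i : ℚ)),
            (fun j => ((graverCol b c mx my).2 j : ℚ))) : (Fin h1 → ℚ) × (Fin h2 → ℚ)) =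
          ∑ s, q s • (((fun i => ((simpleCol b c s).1 i : ℚ)),
            (fun j => ((simpleCol b c s).2 j : ℚ))) : (Fin h1 → ℚ) × (Fin h2 → ℚ)) := by
  rw [cone_iff]
  constructor
  · rintro ⟨n, hn, coeffs, hco, heq⟩
    let Φ := Algebra.TensorProduct.productMap
      (toricMap K (fun s : Σ α : Fin d, Fin (dx α) => b s.1 s.2)
        (AddMonoidHom.inl (Fin h1 → ℤ) (Fin h2 → ℤ)))
      (toricMap K (fun s : Σ α : Fin d, Fin (dy α) => c s.1 s.2)
        (AddMonoidHom.inr (Fin h1 → ℤ) (Fin h2 → ℤ)))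
    have hgen : Φ (graverGen K b c mx my) =
        AddMonoidAlgebra.single (graverCol b c mx my) 1 := by
      simp only [Φ, graverGen, Algebra.TensorProduct.productMap_apply_tmul, toricMap_monomial,
        AddMonoidAlgebra.single_mul_single, lc_apply, mul_one]
      simp only [AddMonoidHom.inl_apply, AddMonoidHom.inr_apply, Prod.mk_add_mk, add_zero,
        zero_add]
      rfl
    have hΦ := congrArg Φ heq
    rw [map_add, map_pow, map_sum, map_zero, hgen] at hΦ
    simp only [map_mul, map_pow, hgen] at hΦ
    have hsupp : ∀ i, Φ (coeffs i) ∈ supportedOn K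
        (AddSubmonoid.closure (Set.range (simpleCol b c))) := by
      intro i
      suffices hle : _ ≤ (supportedOn K
          (AddSubmonoid.closure (Set.range (simpleCol b c)))).comap Φ from hle (hco i)
      · refine Algebra.adjoin_le ?_
        rintro _ ⟨s, rfl⟩
        rw [SetLike.mem_coe, Subalgebra.mem_comap]
        simp only [Φ, Algebra.TensorProduct.productMap_apply_tmul, toricMap_X,
          AddMonoidAlgebra.single_mul_single, mul_one]
        intro x hx
        have hx' := Finset.mem_singleton.1 (Finsupp.support_single_subset hx)
        subst hx'
        exact AddSubmonoid.subset_closure ⟨s, by simp [simpleCol]⟩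
    obtain ⟨k, hk, hmem⟩ := supportedOn_key K
      (AddSubmonoid.closure (Set.range (simpleCol b c))) _ n (fun i => Φ (coeffs i)) hsupp hΦ
    exact ⟨k, hk, AddSubmonoid.mem_closure_range_iff_of_fintype.1 hmem⟩
  · rintro ⟨N, hN, k, hk⟩
    have hk1 := congrArg Prod.fst hk
    have hk2 := congrArg Prod.snd hk
    simp only [Prod.fst_sum, Prod.snd_sum, Prod.smul_fst, Prod.smul_snd, graverCol,
      simpleCol] at hk1 hk2
    exact monic_tmul
      (fun s : (Σ α : Fin d, Fin (dx α) × Fin (dy α)) => Ideal.Quotient.mk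
        (toricIdeal K (fun t : Σ α : Fin d, Fin (dx α) => b t.1 t.2)) (X ⟨s.1, s.2.1⟩))
      (fun s : (Σ α : Fin d, Fin (dx α) × Fin (dy α)) => Ideal.Quotient.mk
        (toricIdeal K (fun t : Σ α : Fin d, Fin (dy α) => c t.1 t.2)) (X ⟨s.1, s.2.2⟩))
      _ _ k N hN
      (toric_prod K (fun t : Σ α : Fin d, Fin (dx α) => b t.1 t.2)
        (fun s : (Σ α : Fin d, Fin (dx α) × Fin (dy α)) => ⟨s.1, s.2.1⟩) k N mx hk1)
      (toric_prod K (fun t : Σ α : Fin d, Fin (dy α) => c t.1 t.2)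
        (fun s : (Σ α : Fin d, Fin (dx α) × Fin (dy α)) => ⟨s.1, s.2.2⟩) k N my hk2)
end
end
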